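/- (Main theorem, case 2 with p = ∞) Assume the data is of Heisenberg type. Let α be a real number with −α ≥ 1, and let ρ : G → ℝ be continuous, nonnegative, with compact support. Define F(g) = ∫_G ρ(g') N(g'⁻¹ · g)^{−α} dg'. Then F is twice continuously differentiable on G and 𝓛_∞F(g) ≥ 0 for every g ∈ G; that is, F is ∞-subharmonic. -/

import Mathlib

open scoped RealInnerProductSpace
open MeasureTheory

noncomputable section

variable {V₁ V₂ : Type*} [NormedAddCommGroup V₁] [InnerProductSpace ℝ V₁]
  [NormedAddCommGroup V₂] [InnerProductSpace ℝ V₂]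

/-- The horizontal derivative of `f : V₁ × V₂ → ℝ` at `g = (z,t)` in the horizontal
direction `v ∈ V₁`, namely `Df(g)(v, ½[z,v])`. -/
def Xd (b : V₁ →ₗ[ℝ] V₁ →ₗ[ℝ] V₂) (v : V₁) (f : V₁ × V₂ → ℝ) (g : V₁ × V₂) : ℝ :=
  fderiv ℝ f g (v, (2⁻¹ : ℝ) • b g.1 v)

/-- The horizontal gradient: the unique vector of `V₁` representing the linear functional
`v ↦ X_v f (g)` via the inner product of `V₁`. -/
def Xgrad [FiniteDimensional ℝ V₁] [FiniteDimensional ℝ V₂]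
    (b : V₁ →ₗ[ℝ] V₁ →ₗ[ℝ] V₂) (f : V₁ × V₂ → ℝ) (g : V₁ × V₂) : V₁ :=
  (InnerProductSpace.toDual ℝ V₁).symm
    (LinearMap.toContinuousLinearMap
      ((fderiv ℝ f g).toLinearMap.comp
        (LinearMap.prod LinearMap.id ((2⁻¹ : ℝ) • b g.1))))

/-- The symmetrized second horizontal derivative `f_{,uv} = ½(X_u X_v f + X_v X_u f)`. -/
def X2sym (b : V₁ →ₗ[ℝ] V₁ →ₗ[ℝ] V₂) (u v : V₁) (f : V₁ × V₂ → ℝ) (g : V₁ × V₂) : ℝ :=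
  (Xd b u (Xd b v f) g + Xd b v (Xd b u f) g) / 2

/-- The horizontal (sub-)Laplacian `𝓛 f = Σᵢ X_{eᵢ} X_{eᵢ} f`. -/
def hLap [FiniteDimensional ℝ V₁] (b : V₁ →ₗ[ℝ] V₁ →ₗ[ℝ] V₂) (f : V₁ × V₂ → ℝ)
    (g : V₁ × V₂) : ℝ :=
  ∑ i, Xd b (stdOrthonormalBasis ℝ V₁ i) (Xd b (stdOrthonormalBasis ℝ V₁ i) f) g

/-- The horizontal ∞-Laplacian `𝓛_∞ f = Σ_{i,j} f_{,eᵢeⱼ} X_{eᵢ}f X_{eⱼ}f`. -/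
def hInfLap [FiniteDimensional ℝ V₁] (b : V₁ →ₗ[ℝ] V₁ →ₗ[ℝ] V₂) (f : V₁ × V₂ → ℝ)
    (g : V₁ × V₂) : ℝ :=
  ∑ i, ∑ j, X2sym b (stdOrthonormalBasis ℝ V₁ i) (stdOrthonormalBasis ℝ V₁ j) f g *
    Xd b (stdOrthonormalBasis ℝ V₁ i) f g * Xd b (stdOrthonormalBasis ℝ V₁ j) f g

/-- `ψ(z,t) = |z|²`. -/
def psiF (g : V₁ × V₂) : ℝ := ‖g.1‖ ^ 2

/-- `χ(z,t) = |t|²`. -/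
def chiF (g : V₁ × V₂) : ℝ := ‖g.2‖ ^ 2

/-- `a(z,t) = ψ² + 16χ = |z|⁴ + 16|t|²`. -/
def aF (g : V₁ × V₂) : ℝ := psiF g ^ 2 + 16 * chiF g

/-- The Folland–Kaplan gauge `N = a^{1/4}`. -/
def Ng (g : V₁ × V₂) : ℝ := aF g ^ ((1 : ℝ) / 4)

/-- `A(z,t) = |z|² z + 4 J(t) z`. -/
def Ag (J : V₂ → V₁ →ₗ[ℝ] V₁) (g : V₁ × V₂) : V₁ :=
  ‖g.1‖ ^ 2 • g.1 + (4 : ℝ) • J g.2 g.1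

/-- The group law `(z,t)·(z',t') = (z+z', t+t'+½[z,z'])`. -/
def gmul (b : V₁ →ₗ[ℝ] V₁ →ₗ[ℝ] V₂) (g h : V₁ × V₂) : V₁ × V₂ :=
  (g.1 + h.1, g.2 + h.2 + (2⁻¹ : ℝ) • b g.1 h.1)

/-- The group inverse `(z,t)⁻¹ = (−z,−t)`. -/
def ginv (g : V₁ × V₂) : V₁ × V₂ := (-g.1, -g.2)

end

section RieszAux
open Filter Topology Set
set_option linter.unusedSectionVars false

variable {E W W' : Type*} [NormedAddCommGroup E] [NormedSpace ℝ E] [FiniteDimensional ℝ E]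
  [MeasurableSpace E] [BorelSpace E]
  [NormedAddCommGroup W] [NormedSpace ℝ W]
  [NormedAddCommGroup W'] [NormedSpace ℝ W']

/-- Local `L¹` convergence of continuous functions. -/
structure LConv (μ : Measure E) (Φn : ℕ → E → W) (Φ : E → W) : Prop where
  cont : ∀ n, Continuous (Φn n)
  loc : LocallyIntegrable Φ μ
  lim : ∀ S : Set E, IsCompact S →
    Tendsto (fun n => ∫ x in S, ‖Φn n x - Φ x‖ ∂μ) atTop (𝓝 0)

/-- The twisted convolution. -/
noncomputable def Iop (μ : Measure E) (c : E → E) (L : E → E →L[ℝ] E) (R : E → W →L[ℝ] W')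
    (Φ : E → W) (g : E) : W' := ∫ x, R x (Φ (c x + L x g)) ∂μ

/-- The differentiated weight. -/
noncomputable def Rder (L : E → E →L[ℝ] E) (R : E → W →L[ℝ] W') (x : E) :
    (E →L[ℝ] W) →L[ℝ] (E →L[ℝ] W') :=
  ((ContinuousLinearMap.compL ℝ E W W') (R x)).comp
    ((ContinuousLinearMap.compL ℝ E E W).flip (L x))

lemma Rder_apply (L : E → E →L[ℝ] E) (R : E → W →L[ℝ] W') (x : E) (M : E →L[ℝ] W) :
    Rder L R x M = (R x).comp (M.comp (L x)) := rfl

lemma Rder_cont {L : E → E →L[ℝ] E} {R : E → W →L[ℝ] W'} (hL : Continuous L)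
    (hR : Continuous R) : Continuous (Rder L R) := by
  unfold Rder
  exact ((ContinuousLinearMap.compL ℝ E W W').continuous.comp hR).clm_comp
    ((ContinuousLinearMap.compL ℝ E E W).flip.continuous.comp hL)

lemma Rder_supp {L : E → E →L[ℝ] E} {R : E → W →L[ℝ] W'} 
    (hR : HasCompactSupport R) : HasCompactSupport (Rder L R) := by
  refine hR.mono ?_
  intro x hx hx'
  apply hx
  ext M v
  simp [Rder_apply, hx']

variable {μ : Measure E} [IsLocallyFiniteMeasure μ] {c : E → E} {L : E → E →L[ℝ] E}
  {R : E → W →L[ℝ] W'}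

lemma supp_cont_int {Φ : E → W} (hc : Continuous c) (hL : Continuous L) (hR : Continuous R)
    (hRs : HasCompactSupport R) (hΦ : Continuous Φ) (g : E) :
    Continuous (fun x => R x (Φ (c x + L x g))) ∧
    Integrable (fun x => R x (Φ (c x + L x g))) μ := by
  have h : Continuous (fun x => R x (Φ (c x + L x g))) :=
    hR.clm_apply (hΦ.comp (hc.add (hL.clm_apply continuous_const)))
  refine ⟨h, h.integrable_of_hasCompactSupport ?_⟩
  refine hRs.mono ?_
  intro x hx hx'
  apply hx
  simp [hx']

lemma Iop_hasFDerivAt {Φ : E → W} {Φ' : E → E →L[ℝ] W}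
    (hc : Continuous c) (hL : Continuous L) (hR : Continuous R)
    (hRs : HasCompactSupport R) (hΦ : ∀ x, HasFDerivAt Φ (Φ' x) x) (hΦ' : Continuous Φ') (g : E) :
    HasFDerivAt (Iop μ c L R Φ) (Iop μ c L (Rder L R) Φ' g) g := by
  have hΦc : Continuous Φ := continuous_iff_continuousAt.2 fun x => (hΦ x).continuousAt
  have hR'c := Rder_cont hL hR
  have hR's := Rder_supp (L := L) hRs
  have hcont : Continuous (fun p : E × E => Rder L R p.1 (Φ' (c p.1 + L p.1 p.2))) :=
    (hR'c.comp continuous_fst).clm_apply (hΦ'.comp ((hc.comp continuous_fst).add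
      ((hL.comp continuous_fst).clm_apply continuous_snd)))
  obtain ⟨C, hC⟩ := (hR's.isCompact.prod (isCompact_closedBall g 1)).exists_bound_of_continuousOn
    hcont.continuousOn
  refine hasFDerivAt_integral_of_dominated_of_fderiv_le
    (bound := (tsupport (Rder L R)).indicator (fun _ => C))
    (F' := fun g x => Rder L R x (Φ' (c x + L x g)))
    (Metric.closedBall_mem_nhds g one_pos)
    (Eventually.of_forall fun g => (supp_cont_int (μ := μ) hc hL hR hRs hΦc g).1.aestronglyMeasurable)
    (supp_cont_int hc hL hR hRs hΦc g).2
    (supp_cont_int (μ := μ) hc hL hR'c hR's hΦ' g).1.aestronglyMeasurable ?_ ?_ ?_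
  · refine Eventually.of_forall fun x y hy => ?_
    by_cases hx : x ∈ tsupport (Rder L R)
    · rw [indicator_of_mem hx]
      exact hC (x, y) ⟨hx, hy⟩
    · rw [indicator_of_notMem hx, image_eq_zero_of_notMem_tsupport hx]
      simp
  · exact (integrable_indicator_iff hR's.isCompact.isClosed.measurableSet).2
      (integrableOn_const hR's.isCompact.measure_lt_top.ne)
  · refine Eventually.of_forall fun x y hy => ?_
    rw [Rder_apply]
    have h1 : HasFDerivAt (fun y => c x + L x y) (L x) y := (L x).hasFDerivAt.const_add _
    exact (R x).hasFDerivAt.comp y ((hΦ _).comp y h1)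

/-- Bound for twisted convolution. -/
lemma Iop_bound (hc : Continuous c) (hL : Continuous L) (hR : Continuous R)
    (hRs : HasCompactSupport R) (hT : ∀ g, MeasurePreserving (fun x => c x + L x g) μ μ)
    (Kg : Set E) (hK : IsCompact Kg) :
    ∃ C : ℝ, ∃ S : Set E, IsCompact S ∧ 0 ≤ C ∧ ∀ Φ : E → W, LocallyIntegrable Φ μ → ∀ g ∈ Kg,
      Integrable (fun x => R x (Φ (c x + L x g))) μ ∧
      ‖Iop μ c L R Φ g‖ ≤ C * ∫ x in S, ‖Φ x‖ ∂μ := by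
  obtain ⟨C, hC⟩ := hRs.exists_bound_of_continuous hR
  have hcont : Continuous (fun p : E × E => c p.1 + L p.1 p.2) :=
    (hc.comp continuous_fst).add ((hL.comp continuous_fst).clm_apply continuous_snd)
  refine ⟨C, (fun p : E × E => c p.1 + L p.1 p.2) '' (tsupport R ×ˢ Kg),
    (hRs.isCompact.prod hK).image hcont, (norm_nonneg _).trans (hC 0), fun Φ hΦ g hg => ?_⟩
  set S := (fun p : E × E => c p.1 + L p.1 p.2) '' (tsupport R ×ˢ Kg) with hS
  have hSc : IsCompact S := (hRs.isCompact.prod hK).image hcont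
  have hSm : MeasurableSet S := hSc.isClosed.measurableSet
  have hi : Integrable (S.indicator (fun x => ‖Φ x‖)) μ :=
    (integrable_indicator_iff hSm).2 (hΦ.integrableOn_isCompact hSc).norm
  have hi2 : Integrable (fun x => C * S.indicator (fun x => ‖Φ x‖) (c x + L x g)) μ :=
    ((hT g).integrable_comp_of_integrable hi).const_mul C
  have hb : ∀ x, ‖R x (Φ (c x + L x g))‖ ≤ C * S.indicator (fun x => ‖Φ x‖) (c x + L x g) := by
    intro x
    by_cases hx : x ∈ tsupport R
    · rw [indicator_of_mem (show c x + L x g ∈ S from ⟨(x, g), ⟨hx, hg⟩, rfl⟩)]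
      exact (R x).le_of_opNorm_le (hC x) _
    · rw [image_eq_zero_of_notMem_tsupport hx]
      simp only [zero_apply, norm_zero]
      exact mul_nonneg ((norm_nonneg _).trans (hC 0)) (indicator_nonneg (fun _ _ => norm_nonneg _) _)
  have hm : AEStronglyMeasurable (fun x => R x (Φ (c x + L x g))) μ := by
    have h1 : AEStronglyMeasurable (fun x => Φ (c x + L x g)) μ :=
      hΦ.aestronglyMeasurable.comp_measurePreserving (hT g)
    exact (isBoundedBilinearMap_apply (𝕜 := ℝ) (E := W) (F := W')).continuous.comp_aestronglyMeasurable
      (hR.aestronglyMeasurable.prodMk h1)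
  refine ⟨hi2.mono' hm (Eventually.of_forall hb), ?_⟩
  refine (norm_integral_le_of_norm_le hi2 (Eventually.of_forall hb)).trans ?_
  rw [integral_const_mul, ← integral_indicator hSm]
  refine le_of_eq ?_
  congr 1
  have := integral_map (hT g).aemeasurable (f := S.indicator (fun x => ‖Φ x‖))
    (by rw [(hT g).map_eq]; exact hi.aestronglyMeasurable)
  rw [(hT g).map_eq] at this
  exact this.symm

lemma Iop_tendsto {Φn : ℕ → E → W} {Φ : E → W} (hc : Continuous c) (hL : Continuous L)
    (hR : Continuous R) (hRs : HasCompactSupport R)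
    (hT : ∀ g, MeasurePreserving (fun x => c x + L x g) μ μ) (h : LConv μ Φn Φ) :
    TendstoLocallyUniformlyOn (fun n => Iop μ c L R (Φn n)) (Iop μ c L R Φ) atTop univ := by
  rw [tendstoLocallyUniformlyOn_iff_forall_isCompact isOpen_univ]
  intro Kg _ hK
  obtain ⟨C, S, hS, hC0, hb⟩ := Iop_bound hc hL hR hRs hT Kg hK
  rw [Metric.tendstoUniformlyOn_iff]
  intro ε hε
  have h2 : Tendsto (fun n => C * ∫ x in S, ‖Φn n x - Φ x‖ ∂μ) atTop (𝓝 0) := by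
    simpa using (h.lim S hS).const_mul C
  filter_upwards [h2.eventually (gt_mem_nhds hε)] with n hn g hg
  have hn1 : LocallyIntegrable (Φn n) μ := (h.cont n).locallyIntegrable
  have e : Iop μ c L R (fun x => Φn n x - Φ x) g = Iop μ c L R (Φn n) g - Iop μ c L R Φ g := by
    unfold Iop
    rw [← integral_sub (hb _ hn1 g hg).1 (hb _ h.loc g hg).1]
    simp only [map_sub]
  rw [dist_comm, dist_eq_norm, ← e]
  exact ((hb _ (hn1.sub h.loc) g hg).2).trans_lt hn

lemma Iop_cont {Φn : ℕ → E → W} {Φ : E → W} (hc : Continuous c) (hL : Continuous L)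
    (hR : Continuous R) (hRs : HasCompactSupport R)
    (hT : ∀ g, MeasurePreserving (fun x => c x + L x g) μ μ) (h : LConv μ Φn Φ)
    (hn : ∀ n, Continuous (Iop μ c L R (Φn n))) :
    Continuous (Iop μ c L R Φ) := by
  rw [← continuousOn_univ]
  exact (Iop_tendsto hc hL hR hRs hT h).continuousOn
    (Frequently.of_forall fun n => (hn n).continuousOn)

lemma Iop_cont_smooth {Φ : E → W} (hc : Continuous c) (hL : Continuous L)
    (hR : Continuous R) (hRs : HasCompactSupport R) (hΦ : Continuous Φ) :
    Continuous (Iop μ c L R Φ) := by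
  unfold Iop
  have hcont : Continuous (fun p : E × E => R p.2 (Φ (c p.2 + L p.2 p.1))) :=
    (hR.comp continuous_snd).clm_apply (hΦ.comp ((hc.comp continuous_snd).add
      ((hL.comp continuous_snd).clm_apply continuous_fst)))
  rw [← continuousOn_univ]
  have := continuousOn_integral_of_compact_support (μ := μ) (s := univ) (k := tsupport R) 
    (f := fun g x => R x (Φ (c x + L x g))) hRs.isCompact hcont.continuousOn (by
      intro p x _ hx
      rw [image_eq_zero_of_notMem_tsupport hx]; simp)
  exact this

lemma Iop_limit_hasFDerivAt {Φn : ℕ → E → W} {Φ : E → W} {Ψn : ℕ → E → E →L[ℝ] W}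
    {Ψ : E → E →L[ℝ] W} (hc : Continuous c) (hL : Continuous L)
    (hR : Continuous R) (hRs : HasCompactSupport R)
    (hT : ∀ g, MeasurePreserving (fun x => c x + L x g) μ μ) (h : LConv μ Φn Φ)
    (h' : LConv μ Ψn Ψ) (hd : ∀ n x, HasFDerivAt (Φn n) (Ψn n x) x) (g : E) :
    HasFDerivAt (Iop μ c L R Φ) (Iop μ c L (Rder L R) Ψ g) g := by
  refine hasFDerivAt_of_tendstoLocallyUniformlyOn isOpen_univ
    (Iop_tendsto hc hL (Rder_cont hL hR) (Rder_supp hRs) hT h')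
    (fun n x _ => Iop_hasFDerivAt hc hL hR hRs (hd n) (h'.cont n) x)
    (fun x hx => (Iop_tendsto hc hL hR hRs hT h).tendsto_at hx) (mem_univ g)

/-- `L¹_loc` convergence by domination. -/
lemma LConv.of_dominated {Φn : ℕ → E → W} {Φ : E → W} {w : E → ℝ}
    (hcont : ∀ n, Continuous (Φn n)) (hw : LocallyIntegrable w μ)
    (hlim : ∀ᵐ x ∂μ, Tendsto (fun n => Φn n x) atTop (𝓝 (Φ x)))
    (hb : ∀ S : Set E, IsCompact S → ∃ C : ℝ, ∀ n, ∀ᵐ x ∂μ, x ∈ S → ‖Φn n x‖ ≤ C * w x) :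
    LConv μ Φn Φ := by
  have hm : AEStronglyMeasurable Φ μ :=
    aestronglyMeasurable_of_tendsto_ae atTop (fun n => (hcont n).aestronglyMeasurable) hlim
  have hb2 : ∀ S : Set E, IsCompact S → ∃ C : ℝ, (∀ n, ∀ᵐ x ∂μ, x ∈ S → ‖Φn n x‖ ≤ C * w x) ∧
      ∀ᵐ x ∂μ, x ∈ S → ‖Φ x‖ ≤ C * w x := by
    intro S hS
    obtain ⟨C, hC⟩ := hb S hS
    refine ⟨C, hC, ?_⟩
    filter_upwards [hlim, ae_all_iff.2 hC] with x hx h2 hxS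
    exact le_of_tendsto hx.norm (Eventually.of_forall fun n => h2 n hxS)
  refine ⟨hcont, ?_, ?_⟩
  · rw [locallyIntegrable_iff]
    intro S hS
    obtain ⟨C, _, hC⟩ := hb2 S hS
    exact Integrable.mono' ((hw.integrableOn_isCompact hS).const_mul C) hm.restrict
      ((ae_restrict_iff' hS.isClosed.measurableSet).2 hC)
  · intro S hS
    obtain ⟨C, hC1, hC⟩ := hb2 S hS
    have := tendsto_integral_of_dominated_convergence (μ := μ.restrict S)
      (F := fun n x => ‖Φn n x - Φ x‖) (f := fun _ => 0) (fun x => 2 * (C * w x))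
      (fun n => (((hcont n).aestronglyMeasurable.sub hm).norm).restrict)
      (((hw.integrableOn_isCompact hS).const_mul C).const_mul 2) (by
        intro n
        rw [ae_restrict_iff' hS.isClosed.measurableSet]
        filter_upwards [hC1 n, hC] with x h1 h2 hx
        rw [norm_norm]
        have := norm_sub_le (Φn n x) (Φ x)
        linarith [h1 hx, h2 hx]) (by
        refine ae_restrict_of_ae ?_
        filter_upwards [hlim] with x hx
        simpa using (hx.sub_const (Φ x)).norm)
    simpa using this

end RieszAux

section RieszAux2
open Filter Topology Set
set_option linter.unusedSectionVars false
set_option maxSynthPendingDepth 3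

variable {V₁ V₂ : Type*} [NormedAddCommGroup V₁] [InnerProductSpace ℝ V₁]
  [NormedAddCommGroup V₂] [InnerProductSpace ℝ V₂]

lemma aF_contDiff : ContDiff ℝ 3 (aF : V₁ × V₂ → ℝ) := by
  unfold aF psiF chiF
  exact ((contDiff_fst.norm_sq ℝ).pow 2).add (contDiff_const.mul (contDiff_snd.norm_sq ℝ))

lemma aF_fderiv (g v : V₁ × V₂) :
    fderiv ℝ (aF : V₁ × V₂ → ℝ) g v = 4 * ‖g.1‖ ^ 2 * ⟪g.1, v.1⟫ + 32 * ⟪g.2, v.2⟫ := by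
  have h1 : HasFDerivAt (fun g : V₁ × V₂ => ‖g.1‖ ^ 2) _ g :=
    (hasFDerivAt_fst (𝕜 := ℝ) (p := g)).norm_sq
  have h2 : HasFDerivAt (fun g : V₁ × V₂ => ‖g.2‖ ^ 2) _ g :=
    (hasFDerivAt_snd (𝕜 := ℝ) (p := g)).norm_sq
  have h : HasFDerivAt (aF : V₁ × V₂ → ℝ) _ g := (h1.pow 2).add (h2.const_mul 16)
  rw [h.fderiv]
  simp
  ring

lemma aF_fderiv2 (g v : V₁ × V₂) :
    fderiv ℝ (fderiv ℝ (aF : V₁ × V₂ → ℝ)) g v v =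
      4 * ‖g.1‖ ^ 2 * ‖v.1‖ ^ 2 + 8 * ⟪g.1, v.1⟫ ^ 2 + 32 * ‖v.2‖ ^ 2 := by
  have hd : DifferentiableAt ℝ (fderiv ℝ (aF : V₁ × V₂ → ℝ)) g :=
    ((aF_contDiff.fderiv_right (m := 1) (by norm_num)).differentiable (by norm_num)) g
  have e : fderiv ℝ (fun x => fderiv ℝ (aF : V₁ × V₂ → ℝ) x v) g v =
      fderiv ℝ (fderiv ℝ (aF : V₁ × V₂ → ℝ)) g v v := by
    rw [fderiv_clm_apply hd (differentiableAt_const v)]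
    simp
  rw [← e]
  simp only [aF_fderiv]
  have h1 : HasFDerivAt (fun g : V₁ × V₂ => ‖g.1‖ ^ 2) _ g :=
    (hasFDerivAt_fst (𝕜 := ℝ) (p := g)).norm_sq
  have h3 : HasFDerivAt (fun g : V₁ × V₂ => ⟪g.1, v.1⟫) _ g :=
    (hasFDerivAt_fst (𝕜 := ℝ) (p := g)).inner ℝ (hasFDerivAt_const v.1 g)
  have h4 : HasFDerivAt (fun g : V₁ × V₂ => ⟪g.2, v.2⟫) _ g :=
    (hasFDerivAt_snd (𝕜 := ℝ) (p := g)).inner ℝ (hasFDerivAt_const v.2 g)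
  have h := ((h1.const_mul 4).mul h3).add (h4.const_mul 32)
  refine (congrArg (fun M : V₁ × V₂ →L[ℝ] ℝ => M v) (HasFDerivAt.fderiv h)).trans ?_
  simp [real_inner_self_eq_norm_sq]
  ring

lemma aF_nonneg (g : V₁ × V₂) : 0 ≤ aF g := by
  unfold aF psiF chiF; positivity

lemma aF_fderiv_norm (g : V₁ × V₂) :
    ‖fderiv ℝ (aF : V₁ × V₂ → ℝ) g‖ ^ 2 ≤ (160 + 32 * aF g) * aF g := by
  have hz := norm_nonneg g.1
  have ht := norm_nonneg g.2
  have h : ‖fderiv ℝ (aF : V₁ × V₂ → ℝ) g‖ ≤ 4 * ‖g.1‖ ^ 3 + 32 * ‖g.2‖ := by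
    refine ContinuousLinearMap.opNorm_le_bound _ (by positivity) fun v => ?_
    rw [aF_fderiv, Real.norm_eq_abs]
    have h1 := abs_real_inner_le_norm g.1 v.1
    have h2 := abs_real_inner_le_norm g.2 v.2
    have h3 : ‖g.1‖ * ‖v.1‖ ≤ ‖g.1‖ * ‖v‖ := by gcongr; exact norm_fst_le v
    have h4 : ‖g.2‖ * ‖v.2‖ ≤ ‖g.2‖ * ‖v‖ := by gcongr; exact norm_snd_le v
    calc |4 * ‖g.1‖ ^ 2 * ⟪g.1, v.1⟫ + 32 * ⟪g.2, v.2⟫|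
        ≤ |4 * ‖g.1‖ ^ 2 * ⟪g.1, v.1⟫| + |32 * ⟪g.2, v.2⟫| := abs_add_le _ _
      _ = 4 * ‖g.1‖ ^ 2 * |⟪g.1, v.1⟫| + 32 * |⟪g.2, v.2⟫| := by
          rw [abs_mul (4 * ‖g.1‖ ^ 2), abs_mul 32, abs_of_nonneg (by positivity : 0 ≤ 4 * ‖g.1‖ ^ 2)]; norm_num
      _ ≤ 4 * ‖g.1‖ ^ 2 * (‖g.1‖ * ‖v‖) + 32 * (‖g.2‖ * ‖v‖) := by
          gcongr
          · exact h1.trans h3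
          · exact h2.trans h4
      _ = _ := by ring
  have h5 : ‖fderiv ℝ (aF : V₁ × V₂ → ℝ) g‖ ^ 2 ≤ (4 * ‖g.1‖ ^ 3 + 32 * ‖g.2‖) ^ 2 := by gcongr
  refine h5.trans ?_
  unfold aF psiF chiF
  have h6 : ‖g.1‖ ^ 2 ≤ 1 + ((‖g.1‖ ^ 2) ^ 2 + 16 * ‖g.2‖ ^ 2) := by
    nlinarith [sq_nonneg (‖g.1‖ ^ 2 - 1), sq_nonneg ‖g.2‖]
  set A := ((‖g.1‖ ^ 2) ^ 2 + 16 * ‖g.2‖ ^ 2) with hA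
  have hA0 : 0 ≤ A := by positivity
  calc (4 * ‖g.1‖ ^ 3 + 32 * ‖g.2‖) ^ 2 ≤ 2 * (4 * ‖g.1‖ ^ 3) ^ 2 + 2 * (32 * ‖g.2‖) ^ 2 := by
        nlinarith [sq_nonneg (4 * ‖g.1‖ ^ 3 - 32 * ‖g.2‖)]
    _ = 32 * ‖g.1‖ ^ 2 * (‖g.1‖ ^ 2) ^ 2 + 128 * (16 * ‖g.2‖ ^ 2) := by ring
    _ ≤ 32 * ‖g.1‖ ^ 2 * A + 128 * A := by
        gcongr
        · rw [hA]; nlinarith [sq_nonneg ‖g.2‖]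
        · rw [hA]; nlinarith [sq_nonneg (‖g.1‖^2)]
    _ ≤ 32 * (1 + A) * A + 128 * A := by gcongr
    _ = _ := by ring

lemma skew_self (b : V₁ →ₗ[ℝ] V₁ →ₗ[ℝ] V₂) (hskew : ∀ z z' : V₁, b z z' = - b z' z) (z : V₁) :
    b z z = 0 := by
  have h : (2 : ℝ) • b z z = 0 := by
    rw [two_smul]
    nth_rewrite 1 [hskew]
    simp
  simpa using h

/-- Horizontal convexity inequality. -/
lemma key_ineq (b : V₁ →ₗ[ℝ] V₁ →ₗ[ℝ] V₂) (hskew : ∀ z z' : V₁, b z z' = - b z' z)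
    (J : V₂ → V₁ →ₗ[ℝ] V₁) (hJ : ∀ (t : V₂) (z z' : V₁), ⟪J t z, z'⟫ = ⟪b z z', t⟫)
    (hH : ∀ (t : V₂) (z : V₁), ‖J t z‖ = ‖t‖ * ‖z‖) (h : V₁ × V₂) (w : V₁) :
    3 / 4 * (fderiv ℝ (aF : V₁ × V₂ → ℝ) h (w, (2⁻¹ : ℝ) • b h.1 w)) ^ 2 ≤
      aF h * fderiv ℝ (fderiv ℝ (aF : V₁ × V₂ → ℝ)) h (w, (2⁻¹ : ℝ) • b h.1 w)
        (w, (2⁻¹ : ℝ) • b h.1 w) := by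
  rw [aF_fderiv2, aF_fderiv]
  obtain ⟨z, t⟩ := h
  simp only [aF, psiF, chiF, inner_smul_right, norm_smul]
  have hD : ⟪t, b z w⟫ = ⟪J t z, w⟫ := by rw [hJ, real_inner_comm]
  have hzJ : ⟪z, J t z⟫ = 0 := by
    rw [real_inner_comm, hJ]
    have : b z z = 0 := skew_self b hskew z
    rw [this, inner_zero_left]
  rw [hD]
  set B := ⟪z, w⟫ with hB
  set D := ⟪J t z, w⟫ with hDd
  set τ := ‖t‖ with hτ
  set β := ‖b z w‖ with hβ
  have hτ0 : 0 ≤ τ := norm_nonneg _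
  -- D² ≤ τ² β²
  have h1 : D ^ 2 ≤ τ ^ 2 * β ^ 2 := by
    rw [← mul_pow, ← hD]
    exact sq_le_sq' (by linarith [neg_le_of_abs_le (abs_real_inner_le_norm t (b z w))])
      (real_inner_le_norm _ _)
  -- Bessel
  have h2 : τ ^ 2 * B ^ 2 + D ^ 2 ≤ τ ^ 2 * (‖z‖ ^ 2 * ‖w‖ ^ 2) := by
    have e1 : ⟪(τ ^ 2 * B) • z + D • J t z, w⟫ = τ ^ 2 * B ^ 2 + D ^ 2 := by
      rw [inner_add_left, inner_smul_left, inner_smul_left, ← hB, ← hDd]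
      simp; ring
    have e2 : ‖(τ ^ 2 * B) • z + D • J t z‖ ^ 2 = τ ^ 2 * ‖z‖ ^ 2 * (τ ^ 2 * B ^ 2 + D ^ 2) := by
      rw [norm_add_sq_real, inner_smul_left, inner_smul_right, hzJ, norm_smul, norm_smul, hH,
        mul_pow, mul_pow, Real.norm_eq_abs, Real.norm_eq_abs, sq_abs, sq_abs]
      simp; ring
    have e3 : (τ ^ 2 * B ^ 2 + D ^ 2) ^ 2 ≤ ‖(τ ^ 2 * B) • z + D • J t z‖ ^ 2 * ‖w‖ ^ 2 := by
      rw [← mul_pow (‖(τ ^ 2 * B) • z + D • J t z‖), ← e1]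
      exact sq_le_sq' (by linarith [neg_le_of_abs_le (abs_real_inner_le_norm
        ((τ ^ 2 * B) • z + D • J t z) w)]) (real_inner_le_norm _ _)
    rw [e2] at e3
    by_contra hlt
    push Not at hlt
    have hp : 0 < τ ^ 2 * B ^ 2 + D ^ 2 := lt_of_le_of_lt (by positivity) hlt
    nlinarith
  have h3 : B ^ 2 ≤ ‖z‖ ^ 2 * ‖w‖ ^ 2 := by
    rw [← mul_pow]
    exact sq_le_sq' (by linarith [neg_le_of_abs_le (abs_real_inner_le_norm z w)])
      (real_inner_le_norm _ _)
  norm_num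
  generalize ‖w‖ ^ 2 = C at *
  generalize hA : ‖z‖ ^ 2 = A at *
  have hA0 : 0 ≤ A := by rw [← hA]; positivity
  rcases hτ0.eq_or_lt with h0 | hpos
  · rw [← h0] at h1 ⊢
    have hD0 : D = 0 := by nlinarith [sq_nonneg D]
    rw [hD0]
    nlinarith [mul_nonneg (mul_nonneg hA0 hA0) (sub_nonneg.2 h3),
      mul_nonneg (mul_nonneg hA0 hA0) (sq_nonneg β)]
  · obtain ⟨e, he⟩ : ∃ e, D = τ * e := ⟨D / τ, by field_simp⟩
    have ht2 : 0 < τ ^ 2 := by positivity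
    have h1' : e ^ 2 ≤ β ^ 2 := by
      rw [he] at h1; refine le_of_mul_le_mul_left ?_ ht2; linarith [mul_pow τ e 2]
    have h2' : B ^ 2 + e ^ 2 ≤ A * C := by
      rw [he] at h2; refine le_of_mul_le_mul_left ?_ ht2; linarith [mul_pow τ e 2]
    rw [he]
    have k1 : (A * B + 4 * τ * e) ^ 2 ≤ (A ^ 2 + 16 * τ ^ 2) * (B ^ 2 + e ^ 2) := by
      nlinarith [sq_nonneg (A * e - 4 * τ * B)]
    have k2 : (A ^ 2 + 16 * τ ^ 2) * (12 * (B ^ 2 + e ^ 2)) ≤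
      (A ^ 2 + 16 * τ ^ 2) * (4 * A * C + 8 * B ^ 2 + 8 * β ^ 2) := by
      gcongr; linarith
    nlinarith

lemma finrank_two [FiniteDimensional ℝ V₁] [FiniteDimensional ℝ V₂]
    (h1 : 1 ≤ Module.finrank ℝ V₁) (h2 : 1 ≤ Module.finrank ℝ V₂)
    (b : V₁ →ₗ[ℝ] V₁ →ₗ[ℝ] V₂) (hskew : ∀ z z' : V₁, b z z' = - b z' z)
    (J : V₂ → V₁ →ₗ[ℝ] V₁) (hJ : ∀ (t : V₂) (z z' : V₁), ⟪J t z, z'⟫ = ⟪b z z', t⟫)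
    (hH : ∀ (t : V₂) (z : V₁), ‖J t z‖ = ‖t‖ * ‖z‖) : 2 ≤ Module.finrank ℝ V₁ := by
  by_contra hlt
  have he : Module.finrank ℝ V₁ = 1 := by omega
  have : Nontrivial V₁ := Module.nontrivial_of_finrank_pos (R := ℝ) (by omega)
  have : Nontrivial V₂ := Module.nontrivial_of_finrank_pos (R := ℝ) (by omega)
  obtain ⟨z, hz⟩ := exists_ne (0 : V₁)
  obtain ⟨t, ht⟩ := exists_ne (0 : V₂)
  obtain ⟨c, hc⟩ := (finrank_eq_one_iff_of_nonzero' z hz).1 he (J t z)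
  have hzJ : ⟪J t z, z⟫ = 0 := by
    rw [hJ]
    have : b z z = 0 := skew_self b hskew z
    rw [this, inner_zero_left]
  have hn : ‖J t z‖ ≠ 0 := by rw [hH]; simp [hz, ht]
  rw [← hc, inner_smul_left, real_inner_self_eq_norm_sq] at hzJ
  have : c = 0 := by simpa [hz] using hzJ
  apply hn
  rw [← hc, this]; simp

lemma norm_rpow_int {V : Type*} [NormedAddCommGroup V] [InnerProductSpace ℝ V]
    [FiniteDimensional ℝ V] [MeasurableSpace V] [BorelSpace V] (d : ℕ) (hd : 1 ≤ d)
    (hV : d ≤ Module.finrank ℝ V) (r : ℝ) (hr : r < d) (ρ : ℝ) :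
    IntegrableOn (fun x : V => ‖x‖ ^ (-r)) (Metric.ball 0 ρ) volume := by
  have : Nontrivial V := Module.nontrivial_of_finrank_pos (R := ℝ) (by omega)
  have := (integrableOn_fun_norm_addHaar (volume : Measure V) (f := fun y : ℝ => y ^ (-r)) (r := ρ)).2
  refine this ?_
  have h1 : IntegrableOn (fun y : ℝ => y ^ (((Module.finrank ℝ V - 1 : ℕ) : ℝ) - r)) (Ioo 0 ρ) := by
    rcases le_or_gt ρ 0 with h | h
    · simp [Ioo_eq_empty_of_le h]
    refine (intervalIntegral.integrableOn_Ioo_rpow_iff h).2 ?_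
    have : ((d - 1 : ℕ) : ℝ) ≤ ((Module.finrank ℝ V - 1 : ℕ) : ℝ) := by
      exact_mod_cast (by omega)
    rw [Nat.cast_sub hd] at this
    push_cast at this
    linarith
  refine h1.congr_fun ?_ measurableSet_Ioo
  intro y hy
  simp only [smul_eq_mul]
  rw [sub_eq_add_neg, Real.rpow_add hy.1, Real.rpow_natCast]

/-- weight -/
noncomputable def wF (g : V₁ × V₂) : ℝ := ‖g.1‖ ^ (-(3 / 2 : ℝ)) * ‖g.2‖ ^ (-(3 / 4 : ℝ))

lemma wF_loc [FiniteDimensional ℝ V₁] [FiniteDimensional ℝ V₂]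
    [MeasurableSpace V₁] [BorelSpace V₁] [MeasurableSpace V₂] [BorelSpace V₂]
    (h1 : 2 ≤ Module.finrank ℝ V₁) (h2 : 1 ≤ Module.finrank ℝ V₂) :
    LocallyIntegrable (wF : V₁ × V₂ → ℝ) volume := by
  rw [locallyIntegrable_iff]
  intro S hS
  obtain ⟨ρ, hρ⟩ := hS.isBounded.subset_ball (0 : V₁ × V₂)
  have i1 := norm_rpow_int (V := V₁) 2 (by norm_num) h1 (3 / 2) (by norm_num) ρ
  have i2 := norm_rpow_int (V := V₂) 1 (by norm_num) h2 (3 / 4) (by norm_num) ρ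
  have i3 : IntegrableOn (wF : V₁ × V₂ → ℝ) (Metric.ball 0 ρ ×ˢ Metric.ball 0 ρ) volume := by
    unfold IntegrableOn
    rw [Measure.volume_eq_prod, ← Measure.prod_restrict]
    exact Integrable.mul_prod i1 i2
  refine i3.mono_set (hρ.trans ?_)
  rw [ball_prod_same]; rfl

lemma ae_ne [FiniteDimensional ℝ V₁] [FiniteDimensional ℝ V₂]
    [MeasurableSpace V₁] [BorelSpace V₁] [MeasurableSpace V₂] [BorelSpace V₂]
    (h1 : 2 ≤ Module.finrank ℝ V₁) (h2 : 1 ≤ Module.finrank ℝ V₂) :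
    ∀ᵐ g : V₁ × V₂ ∂volume, 0 < ‖g.1‖ ∧ 0 < ‖g.2‖ := by
  have : Nontrivial V₁ := Module.nontrivial_of_finrank_pos (R := ℝ) (by omega)
  have : Nontrivial V₂ := Module.nontrivial_of_finrank_pos (R := ℝ) (by omega)
  have e1 : ∀ᵐ z : V₁ ∂volume, z ≠ 0 := by simp [ae_iff]
  have e2 : ∀ᵐ z : V₂ ∂volume, z ≠ 0 := by simp [ae_iff]
  have f1 := (Measure.quasiMeasurePreserving_fst (μ := (volume : Measure V₁))
    (ν := (volume : Measure V₂))).ae e1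
  have f2 := (Measure.quasiMeasurePreserving_snd (μ := (volume : Measure V₁))
    (ν := (volume : Measure V₂))).ae e2
  rw [Measure.volume_eq_prod]
  filter_upwards [f1, f2] with g h h'
  exact ⟨norm_pos_iff.2 h, norm_pos_iff.2 h'⟩

lemma q_bound (s M ε : ℝ) (hs : 1 / 4 ≤ s) (hε : 0 < ε) (hε1 : ε ≤ 1) (g : V₁ × V₂)
    (hg : 0 < ‖g.1‖ ∧ 0 < ‖g.2‖) (hM : aF g ≤ M) :
    (aF g + ε) ^ (s - 1) ≤ (M + 1) ^ (s - 1 / 4) * wF g := by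
  have ha : 0 ≤ aF g := aF_nonneg g
  have h1 : ‖g.1‖ ^ 2 * ‖g.2‖ ≤ aF g + ε := by
    unfold aF psiF chiF
    nlinarith [sq_nonneg (‖g.1‖ ^ 2 - ‖g.2‖), sq_nonneg (‖g.1‖ ^ 2), sq_nonneg ‖g.2‖]
  have hw : wF g = (‖g.1‖ ^ 2 * ‖g.2‖) ^ (-(3 / 4) : ℝ) := by
    rw [Real.mul_rpow (by positivity) hg.2.le, ← Real.rpow_natCast, ← Real.rpow_mul hg.1.le, wF]
    norm_num
  have hq : 0 < aF g + ε := by linarith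
  rw [hw, show s - 1 = (s - 1 / 4) + (-(3 / 4)) by ring, Real.rpow_add hq]
  have hp : 0 < ‖g.1‖ ^ 2 * ‖g.2‖ := mul_pos (pow_pos hg.1 2) hg.2
  refine mul_le_mul ?_ ?_ (by positivity) (Real.rpow_nonneg (by linarith) _)
  · exact Real.rpow_le_rpow hq.le (by linarith) (by linarith)
  · exact Real.rpow_le_rpow_of_nonpos hp h1 (by norm_num)

end RieszAux2

section RieszAux3
open Filter Topology Set
set_option linter.unusedSectionVars false
set_option maxSynthPendingDepth 3

variable {V₁ V₂ : Type*} [NormedAddCommGroup V₁] [InnerProductSpace ℝ V₁]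
  [NormedAddCommGroup V₂] [InnerProductSpace ℝ V₂]

/-- regularized kernel -/
noncomputable def K0 (s e : ℝ) (g : V₁ × V₂) : ℝ := (aF g + e) ^ s

/-- its derivative -/
noncomputable def K1 (s e : ℝ) (g : V₁ × V₂) : V₁ × V₂ →L[ℝ] ℝ :=
  (s * (aF g + e) ^ (s - 1)) • fderiv ℝ aF g

/-- its second derivative -/
noncomputable def K2 (s e : ℝ) (g : V₁ × V₂) : V₁ × V₂ →L[ℝ] V₁ × V₂ →L[ℝ] ℝ :=
  (s * (aF g + e) ^ (s - 1)) • fderiv ℝ (fderiv ℝ aF) g +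
    (s • ((s - 1) * (aF g + e) ^ (s - 1 - 1)) • fderiv ℝ aF g).smulRight (fderiv ℝ aF g)

lemma aF_hasFDerivAt (e : ℝ) (g : V₁ × V₂) :
    HasFDerivAt (fun g : V₁ × V₂ => aF g + e) (fderiv ℝ aF g) g :=
  ((aF_contDiff.differentiable (by norm_num)) g).hasFDerivAt.add_const e

lemma q_pos {e : ℝ} (he : 0 < e) (g : V₁ × V₂) : 0 < aF g + e := by
  linarith [aF_nonneg g]

lemma K0_hasFDerivAt {s e : ℝ} (he : 0 < e) (g : V₁ × V₂) :
    HasFDerivAt (K0 s e) (K1 s e g) g :=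
  (aF_hasFDerivAt e g).rpow_const (Or.inl (q_pos he g).ne')

lemma K1_hasFDerivAt {s e : ℝ} (he : 0 < e) (g : V₁ × V₂) :
    HasFDerivAt (K1 s e) (K2 s e g) g := by
  have h1 := ((aF_hasFDerivAt e g).rpow_const (p := s - 1) (Or.inl (q_pos he g).ne')).const_mul s
  have hd : HasFDerivAt (fderiv ℝ (aF : V₁ × V₂ → ℝ)) _ g :=
    (((aF_contDiff.fderiv_right (m := 1) (by norm_num)).differentiable (by norm_num)) g).hasFDerivAt
  exact h1.smul hd

lemma q_cont {e : ℝ} (he : 0 < e) (p : ℝ) :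
    Continuous (fun g : V₁ × V₂ => (aF g + e) ^ p) :=
  (aF_contDiff.continuous.add continuous_const).rpow_const fun g => Or.inl (q_pos he g).ne'

lemma DA_cont : Continuous (fderiv ℝ (aF : V₁ × V₂ → ℝ)) :=
  aF_contDiff.continuous_fderiv (by norm_num)

lemma D2A_cont : Continuous (fderiv ℝ (fderiv ℝ (aF : V₁ × V₂ → ℝ))) :=
  (aF_contDiff.fderiv_right (m := 1) (by norm_num)).continuous_fderiv (by norm_num)

lemma K0_cont {s e : ℝ} (he : 0 < e) : Continuous (K0 s e : V₁ × V₂ → ℝ) := q_cont he s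

lemma K1_cont {s e : ℝ} (he : 0 < e) : Continuous (K1 s e : V₁ × V₂ → _) :=
  (continuous_const.mul (q_cont he _)).smul DA_cont

lemma smulRight_cont {X : Type*} [TopologicalSpace X] {E W : Type*} [NormedAddCommGroup E]
    [NormedSpace ℝ E] [NormedAddCommGroup W] [NormedSpace ℝ W] {f : X → E →L[ℝ] ℝ} {h : X → W}
    (hf : Continuous f) (hh : Continuous h) : Continuous fun x => (f x).smulRight (h x) := by
  have : Continuous fun x => ContinuousLinearMap.smulRightL ℝ E W (f x) (h x) :=
    ((ContinuousLinearMap.smulRightL ℝ E W).continuous.comp hf).clm_apply hh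
  exact this

lemma K2_cont {s e : ℝ} (he : 0 < e) : Continuous (K2 s e : V₁ × V₂ → _) := by
  unfold K2
  refine ((continuous_const.mul (q_cont he _)).smul D2A_cont).add (smulRight_cont ?_ DA_cont)
  exact ((continuous_const.mul (q_cont he _)).smul DA_cont).const_smul s

lemma eps_lim : Tendsto (fun n : ℕ => 1 / ((n : ℝ) + 1)) atTop (𝓝 0) :=
  tendsto_one_div_add_atTop_nhds_zero_nat

lemma eps_pos (n : ℕ) : (0 : ℝ) < 1 / ((n : ℝ) + 1) := by positivity

lemma eps_le (n : ℕ) : 1 / ((n : ℝ) + 1) ≤ 1 := by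
  rw [div_le_one (by positivity)]
  have : (0 : ℝ) ≤ n := Nat.cast_nonneg n
  linarith

lemma q_lim (p : ℝ) (g : V₁ × V₂) (hg : 0 < aF g) :
    Tendsto (fun n : ℕ => (aF g + 1 / ((n : ℝ) + 1)) ^ p) atTop (𝓝 ((aF g + 0) ^ p)) :=
  (tendsto_const_nhds.add eps_lim).rpow_const (Or.inl (by simpa using hg.ne'))

lemma aF_pos (g : V₁ × V₂) (hg : 0 < ‖g.1‖ ∧ 0 < ‖g.2‖) : 0 < aF g := by
  have := hg.1
  unfold aF psiF chiF; positivity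

lemma K1_lim (s : ℝ) (g : V₁ × V₂) (hg : 0 < aF g) :
    Tendsto (fun n : ℕ => K1 s (1 / ((n : ℝ) + 1)) g) atTop (𝓝 (K1 s 0 g)) :=
  ((q_lim _ g hg).const_mul s).smul_const _

lemma K2_lim (s : ℝ) (g : V₁ × V₂) (hg : 0 < aF g) :
    Tendsto (fun n : ℕ => K2 s (1 / ((n : ℝ) + 1)) g) atTop (𝓝 (K2 s 0 g)) := by
  unfold K2
  refine (((q_lim _ g hg).const_mul s).smul_const _).add ?_
  have hc : Continuous fun f : V₁ × V₂ →L[ℝ] ℝ => f.smulRight (fderiv ℝ aF g) :=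
    smulRight_cont continuous_id continuous_const
  exact (hc.tendsto _).comp ((((q_lim _ g hg).const_mul (s - 1)).smul_const _).const_smul s)

lemma K0_bound {s e M : ℝ} (he : 0 < e) (he1 : e ≤ 1) (g : V₁ × V₂) (hM : aF g ≤ M) :
    ‖K0 s e g‖ ≤ (M + 1) * (aF g + e) ^ (s - 1) := by
  have hq := q_pos he g
  unfold K0
  rw [Real.norm_of_nonneg (Real.rpow_nonneg hq.le _)]
  have : (aF g + e) ^ s = (aF g + e) * (aF g + e) ^ (s - 1) := by
    rw [Real.rpow_sub_one hq.ne']; field_simp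
  rw [this]
  gcongr

lemma K1_bound {s e M : ℝ} (hs : 0 ≤ s) (he : 0 < e) (g : V₁ × V₂)
    (hM : ‖fderiv ℝ (aF : V₁ × V₂ → ℝ) g‖ ≤ M) :
    ‖K1 s e g‖ ≤ (s * M) * (aF g + e) ^ (s - 1) := by
  have hq := q_pos he g
  have hq2 := Real.rpow_nonneg hq.le (s - 1)
  unfold K1
  rw [norm_smul, Real.norm_of_nonneg (mul_nonneg hs hq2)]
  calc _ ≤ s * (aF g + e) ^ (s - 1) * M := by gcongr
    _ = _ := by ring

lemma K2_bound {s e M : ℝ} (hs : 0 ≤ s) (he : 0 < e) (g : V₁ × V₂) (hM : aF g ≤ M)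
    (hM2 : ‖fderiv ℝ (fderiv ℝ (aF : V₁ × V₂ → ℝ)) g‖ ≤ M) :
    ‖K2 s e g‖ ≤ (s * M + |s * (s - 1)| * (160 + 32 * M)) * (aF g + e) ^ (s - 1) := by
  have hq := q_pos he g
  have hq2 := Real.rpow_nonneg hq.le (s - 1)
  have hq3 := Real.rpow_nonneg hq.le (s - 1 - 1)
  have ha := aF_nonneg g
  unfold K2
  refine (norm_add_le _ _).trans ?_
  rw [add_mul]
  gcongr ?_ + ?_
  · rw [norm_smul, Real.norm_of_nonneg (mul_nonneg hs hq2)]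
    calc _ ≤ s * (aF g + e) ^ (s - 1) * M := by gcongr
      _ = _ := by ring
  · rw [ContinuousLinearMap.norm_smulRight_apply, smul_smul, norm_smul, Real.norm_eq_abs,
      ← mul_assoc s, abs_mul, abs_of_nonneg hq3]
    have h1 := aF_fderiv_norm g
    have h2 : (aF g + e) ^ (s - 1) = (aF g + e) ^ (s - 1 - 1) * (aF g + e) := by
      rw [Real.rpow_sub_one hq.ne' (s - 1)]; field_simp
    calc |s * (s - 1)| * (aF g + e) ^ (s - 1 - 1) * ‖fderiv ℝ aF g‖ * ‖fderiv ℝ aF g‖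
        = |s * (s - 1)| * (aF g + e) ^ (s - 1 - 1) * ‖fderiv ℝ aF g‖ ^ 2 := by ring
      _ ≤ |s * (s - 1)| * (aF g + e) ^ (s - 1 - 1) * ((160 + 32 * M) * (aF g + e)) := by
          gcongr
          refine h1.trans ?_
          gcongr
          · nlinarith
          · linarith
      _ = _ := by rw [h2]; ring

section conv
variable [FiniteDimensional ℝ V₁] [FiniteDimensional ℝ V₂]
    [MeasurableSpace V₁] [BorelSpace V₁] [MeasurableSpace V₂] [BorelSpace V₂]

lemma conv_aux {W : Type*} [NormedAddCommGroup W] [NormedSpace ℝ W]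
    (h1 : 2 ≤ Module.finrank ℝ V₁) (h2 : 1 ≤ Module.finrank ℝ V₂) {s : ℝ} (hs : 1 / 4 ≤ s)
    (Φ : ℝ → V₁ × V₂ → W) (hc : ∀ e, 0 < e → Continuous (Φ e))
    (hl : ∀ g, 0 < aF g → Tendsto (fun n : ℕ => Φ (1 / ((n : ℝ) + 1)) g) atTop (𝓝 (Φ 0 g)))
    (hb : ∀ M : ℝ, 0 ≤ M → ∃ C : ℝ, 0 ≤ C ∧ ∀ e, 0 < e → e ≤ 1 → ∀ g, aF g ≤ M →
      ‖fderiv ℝ (aF : V₁ × V₂ → ℝ) g‖ ≤ M → ‖fderiv ℝ (fderiv ℝ (aF : V₁ × V₂ → ℝ)) g‖ ≤ M →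
      ‖Φ e g‖ ≤ C * (aF g + e) ^ (s - 1)) :
    LConv volume (fun n : ℕ => Φ (1 / ((n : ℝ) + 1))) (Φ 0) := by
  refine LConv.of_dominated (w := wF) (fun n => hc _ (eps_pos n)) (wF_loc h1 h2) ?_ ?_
  · filter_upwards [ae_ne h1 h2] with g hg using hl g (aF_pos g hg)
  · intro S hS
    obtain ⟨M1, hM1⟩ := hS.exists_bound_of_continuousOn
      (aF_contDiff (V₁ := V₁) (V₂ := V₂)).continuous.continuousOn
    obtain ⟨M2, hM2⟩ := hS.exists_bound_of_continuousOn
      (DA_cont (V₁ := V₁) (V₂ := V₂)).continuousOn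
    obtain ⟨M3, hM3⟩ := hS.exists_bound_of_continuousOn
      (D2A_cont (V₁ := V₁) (V₂ := V₂)).continuousOn
    set M := max 0 (max M1 (max M2 M3)) with hM
    have hMa : M1 ≤ M := by simp [hM]
    have hMb : M2 ≤ M := by simp [hM]
    have hMc : M3 ≤ M := by simp [hM]
    obtain ⟨C, hC0, hC⟩ := hb M (by simp [hM])
    refine ⟨C * (M + 1) ^ (s - 1 / 4), fun n => ?_⟩
    filter_upwards [ae_ne h1 h2] with g hg hgS
    have ha : aF g ≤ M := (le_abs_self _).trans ((hM1 g hgS).trans hMa)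
    refine (hC _ (eps_pos n) (eps_le n) g ha ((hM2 g hgS).trans hMb) ((hM3 g hgS).trans hMc)).trans ?_
    rw [mul_assoc]
    gcongr
    exact q_bound s M _ hs (eps_pos n) (eps_le n) g hg ha

lemma conv0 (h1 : 2 ≤ Module.finrank ℝ V₁) (h2 : 1 ≤ Module.finrank ℝ V₂) {s : ℝ}
    (hs : 1 / 4 ≤ s) :
    LConv volume (fun n : ℕ => (K0 s (1 / ((n : ℝ) + 1)) : V₁ × V₂ → _)) (K0 s 0) :=
  conv_aux h1 h2 hs (K0 s) (fun e he => K0_cont he) (fun g hg => q_lim s g hg)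
    fun M hM => ⟨M + 1, by positivity, fun e he he1 g ha _ _ => K0_bound he he1 g ha⟩

lemma conv1 (h1 : 2 ≤ Module.finrank ℝ V₁) (h2 : 1 ≤ Module.finrank ℝ V₂) {s : ℝ}
    (hs : 1 / 4 ≤ s) :
    LConv volume (fun n : ℕ => (K1 s (1 / ((n : ℝ) + 1)) : V₁ × V₂ → _)) (K1 s 0) :=
  have hs0 : 0 ≤ s := by linarith
  conv_aux h1 h2 hs (K1 s) (fun e he => K1_cont he) (fun g hg => K1_lim s g hg)
    fun M hM => ⟨s * M, by positivity, fun e he he1 g ha hb _ => K1_bound hs0 he g hb⟩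

lemma conv2 (h1 : 2 ≤ Module.finrank ℝ V₁) (h2 : 1 ≤ Module.finrank ℝ V₂) {s : ℝ}
    (hs : 1 / 4 ≤ s) :
    LConv volume (fun n : ℕ => (K2 s (1 / ((n : ℝ) + 1)) : V₁ × V₂ → _)) (K2 s 0) :=
  have hs0 : 0 ≤ s := by linarith
  conv_aux h1 h2 hs (K2 s) (fun e he => K2_cont he) (fun g hg => K2_lim s g hg)
    fun M hM => ⟨_, by positivity, fun e he he1 g ha _ hb => K2_bound hs0 he g ha hb⟩

end conv

lemma K2_nonneg (b : V₁ →ₗ[ℝ] V₁ →ₗ[ℝ] V₂) (hskew : ∀ z z' : V₁, b z z' = - b z' z)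
    (J : V₂ → V₁ →ₗ[ℝ] V₁) (hJ : ∀ (t : V₂) (z z' : V₁), ⟪J t z, z'⟫ = ⟪b z z', t⟫)
    (hH : ∀ (t : V₂) (z : V₁), ‖J t z‖ = ‖t‖ * ‖z‖) {s : ℝ} (hs : 1 / 4 ≤ s)
    (h : V₁ × V₂) (w : V₁) :
    0 ≤ K2 s 0 h (w, (2⁻¹ : ℝ) • b h.1 w) (w, (2⁻¹ : ℝ) • b h.1 w) := by
  have hk := key_ineq b hskew J hJ hH h w
  have hD2 : 0 ≤ fderiv ℝ (fderiv ℝ (aF : V₁ × V₂ → ℝ)) h (w, (2⁻¹ : ℝ) • b h.1 w)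
        (w, (2⁻¹ : ℝ) • b h.1 w) := by rw [aF_fderiv2]; positivity
  have hn := aF_fderiv_norm h
  have hle := (fderiv ℝ (aF : V₁ × V₂ → ℝ) h).le_opNorm (w, (2⁻¹ : ℝ) • b h.1 w)
  unfold K2
  simp only [add_zero, add_apply, smul_apply, ContinuousLinearMap.smulRight_apply, smul_eq_mul]
  set D := fderiv ℝ (aF : V₁ × V₂ → ℝ) h (w, (2⁻¹ : ℝ) • b h.1 w)
  set H := fderiv ℝ (fderiv ℝ (aF : V₁ × V₂ → ℝ)) h (w, (2⁻¹ : ℝ) • b h.1 w)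
        (w, (2⁻¹ : ℝ) • b h.1 w)
  have hs0 : 0 ≤ s := by linarith
  rcases (aF_nonneg h).eq_or_lt with h0 | hpos
  · rw [← h0] at hn
    have : ‖fderiv ℝ (aF : V₁ × V₂ → ℝ) h‖ = 0 := by nlinarith [norm_nonneg (fderiv ℝ aF h)]
    rw [this, zero_mul] at hle
    have hD : D = 0 := norm_le_zero_iff.1 hle
    rw [hD, ← h0]
    have := Real.rpow_nonneg (le_refl (0 : ℝ)) (s - 1)
    simp only [mul_zero, add_zero]
    positivity
  · have h2 : aF h ^ (s - 1) = aF h ^ (s - 1 - 1) * aF h := by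
      rw [Real.rpow_sub_one hpos.ne' (s - 1)]; field_simp
    have hp := Real.rpow_nonneg hpos.le (s - 1 - 1)
    rw [h2]
    have : 0 ≤ aF h * H + (s - 1) * D ^ 2 := by nlinarith [sq_nonneg D]
    have := mul_nonneg (mul_nonneg hs0 hp) this
    linarith

lemma Xd_Xd (b : V₁ →ₗ[ℝ] V₁ →ₗ[ℝ] V₂) [FiniteDimensional ℝ V₁] [FiniteDimensional ℝ V₂]
    {F : V₁ × V₂ → ℝ} {DF : V₁ × V₂ → V₁ × V₂ →L[ℝ] ℝ}
    {D2 : V₁ × V₂ → V₁ × V₂ →L[ℝ] V₁ × V₂ →L[ℝ] ℝ}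
    (h1 : ∀ x, HasFDerivAt F (DF x) x) (h2 : ∀ x, HasFDerivAt DF (D2 x) x)
    (u v : V₁) (g : V₁ × V₂) :
    Xd b u (Xd b v F) g = D2 g (u, (2⁻¹ : ℝ) • b g.1 u) (v, (2⁻¹ : ℝ) • b g.1 v) +
      DF g (0, (2⁻¹ : ℝ) • b u v) := by
  have e : Xd b v F = fun x => DF x (v, (2⁻¹ : ℝ) • b x.1 v) := by
    funext x; rw [Xd, (h1 x).fderiv]
  have h3 : HasFDerivAt (fun x : V₁ × V₂ => (v, (2⁻¹ : ℝ) • b x.1 v))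
      ((0 : V₁ × V₂ →L[ℝ] V₁).prod ((2⁻¹ : ℝ) •
        ((LinearMap.toContinuousLinearMap (b.flip v)).comp (ContinuousLinearMap.fst ℝ V₁ V₂)))) g := by
    refine (hasFDerivAt_const v g).prodMk ?_
    have h4 := ((LinearMap.toContinuousLinearMap (b.flip v)).comp
      (ContinuousLinearMap.fst ℝ V₁ V₂)).hasFDerivAt (x := g)
    exact h4.const_smul (2⁻¹ : ℝ)
  rw [e, Xd, ((h2 g).clm_apply h3).fderiv]
  simp [add_comm]

lemma hInf_eq (b : V₁ →ₗ[ℝ] V₁ →ₗ[ℝ] V₂) [FiniteDimensional ℝ V₁] [FiniteDimensional ℝ V₂]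
    (hskew : ∀ z z' : V₁, b z z' = - b z' z)
    {F : V₁ × V₂ → ℝ} {DF : V₁ × V₂ → V₁ × V₂ →L[ℝ] ℝ}
    {D2 : V₁ × V₂ → V₁ × V₂ →L[ℝ] V₁ × V₂ →L[ℝ] ℝ}
    (h1 : ∀ x, HasFDerivAt F (DF x) x) (h2 : ∀ x, HasFDerivAt DF (D2 x) x) (g : V₁ × V₂) :
    ∃ w : V₁, hInfLap b F g = D2 g (w, (2⁻¹ : ℝ) • b g.1 w) (w, (2⁻¹ : ℝ) • b g.1 w) := by
  set c := fun i => Xd b (stdOrthonormalBasis ℝ V₁ i) F g with hc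
  refine ⟨∑ i, c i • stdOrthonormalBasis ℝ V₁ i, ?_⟩
  have e1 : ((∑ i, c i • stdOrthonormalBasis ℝ V₁ i : V₁),
      (2⁻¹ : ℝ) • b g.1 (∑ i, c i • stdOrthonormalBasis ℝ V₁ i)) =
      ∑ i, c i • ((stdOrthonormalBasis ℝ V₁ i : V₁),
        (2⁻¹ : ℝ) • b g.1 (stdOrthonormalBasis ℝ V₁ i)) := by
    ext1
    · simp [Prod.fst_sum]
    · simp only [Prod.snd_sum, Prod.smul_mk, map_sum, map_smul, Finset.smul_sum]
      refine Finset.sum_congr rfl fun i _ => ?_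
      rw [smul_comm]
  rw [e1]
  set η := fun i => ((stdOrthonormalBasis ℝ V₁ i : V₁),
        (2⁻¹ : ℝ) • b g.1 (stdOrthonormalBasis ℝ V₁ i)) with hη
  have e2 : ∀ i j, X2sym b (stdOrthonormalBasis ℝ V₁ i) (stdOrthonormalBasis ℝ V₁ j) F g =
      (D2 g (η i) (η j) + D2 g (η j) (η i)) / 2 := by
    intro i j
    have e3 : DF g (0, (2⁻¹ : ℝ) • b (stdOrthonormalBasis ℝ V₁ i) (stdOrthonormalBasis ℝ V₁ j)) =
      - DF g (0, (2⁻¹ : ℝ) • b (stdOrthonormalBasis ℝ V₁ j) (stdOrthonormalBasis ℝ V₁ i)) := by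
      rw [hskew (stdOrthonormalBasis ℝ V₁ i) (stdOrthonormalBasis ℝ V₁ j), ← map_neg (DF g)]
      congr 1
      simp
    rw [X2sym, Xd_Xd b h1 h2, Xd_Xd b h1 h2, e3]
    ring
  have e4 : D2 g (∑ i, c i • η i) (∑ i, c i • η i) =
      ∑ i, ∑ j, c i * c j * D2 g (η i) (η j) := by
    simp only [map_sum, map_smul, sum_apply, smul_apply, smul_eq_mul, Finset.mul_sum]
    rw [Finset.sum_comm]
    refine Finset.sum_congr rfl fun i _ => Finset.sum_congr rfl fun j _ => ?_
    ring
  have e5 : ∑ i, ∑ j, c i * c j * D2 g (η j) (η i) = ∑ i, ∑ j, c i * c j * D2 g (η i) (η j) := by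
    rw [Finset.sum_comm]
    refine Finset.sum_congr rfl fun i _ => Finset.sum_congr rfl fun j _ => ?_
    ring
  change _ = D2 g (∑ i, c i • η i) (∑ i, c i • η i)
  have e6 : hInfLap b F g = (∑ i, ∑ j, c i * c j * D2 g (η i) (η j) +
      ∑ i, ∑ j, c i * c j * D2 g (η j) (η i)) / 2 := by
    simp only [hInfLap, e2]
    rw [← Finset.sum_add_distrib, Finset.sum_div]
    refine Finset.sum_congr rfl fun i _ => ?_
    rw [← Finset.sum_add_distrib, Finset.sum_div]
    refine Finset.sum_congr rfl fun j _ => ?_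
    simp only [hc]
    ring
  rw [e6, e5, e4]
  ring

end RieszAux3

section RieszAux4
open Filter Topology Set
set_option linter.unusedSectionVars false
set_option maxSynthPendingDepth 3

variable {V₁ V₂ : Type*} [NormedAddCommGroup V₁] [InnerProductSpace ℝ V₁]
  [NormedAddCommGroup V₂] [InnerProductSpace ℝ V₂]
  [FiniteDimensional ℝ V₁] [FiniteDimensional ℝ V₂]

/-- continuous bilinear version of the bracket -/
noncomputable def bC (b : V₁ →ₗ[ℝ] V₁ →ₗ[ℝ] V₂) : V₁ →L[ℝ] V₁ →L[ℝ] V₂ :=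
  LinearMap.toContinuousLinearMap
    ((LinearMap.toContinuousLinearMap : (V₁ →ₗ[ℝ] V₂) ≃ₗ[ℝ] (V₁ →L[ℝ] V₂)).toLinearMap ∘ₗ b)

lemma bC_apply (b : V₁ →ₗ[ℝ] V₁ →ₗ[ℝ] V₂) (u v : V₁) : bC b u v = b u v := rfl

/-- linear part of left translation -/
noncomputable def LTr (b : V₁ →ₗ[ℝ] V₁ →ₗ[ℝ] V₂) (x : V₁ × V₂) : V₁ × V₂ →L[ℝ] V₁ × V₂ :=
  ContinuousLinearMap.id ℝ (V₁ × V₂) - (2⁻¹ : ℝ) •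
    ((ContinuousLinearMap.inr ℝ V₁ V₂).comp ((bC b x.1).comp (ContinuousLinearMap.fst ℝ V₁ V₂)))

lemma LTr_apply (b : V₁ →ₗ[ℝ] V₁ →ₗ[ℝ] V₂) (x g : V₁ × V₂) :
    LTr b x g = (g.1, g.2 - (2⁻¹ : ℝ) • b x.1 g.1) := by
  ext <;> simp [LTr, bC_apply]

lemma LTr_cont (b : V₁ →ₗ[ℝ] V₁ →ₗ[ℝ] V₂) : Continuous (LTr b) := by
  unfold LTr
  have h : Continuous fun x : V₁ × V₂ => (ContinuousLinearMap.inr ℝ V₁ V₂).comp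
      ((bC b x.1).comp (ContinuousLinearMap.fst ℝ V₁ V₂)) :=
    continuous_const.clm_comp
      (((bC b).continuous.comp continuous_fst).clm_comp continuous_const)
  exact continuous_const.sub (h.const_smul (2⁻¹ : ℝ))

lemma ginv_cont : Continuous (ginv : V₁ × V₂ → V₁ × V₂) := by
  unfold ginv; fun_prop

lemma trans_eq (b : V₁ →ₗ[ℝ] V₁ →ₗ[ℝ] V₂) (x g : V₁ × V₂) :
    ginv x + LTr b x g = gmul b (ginv x) g := by
  rw [LTr_apply]
  ext
  · simp [ginv, gmul]
  · simp [ginv, gmul]; abel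

lemma trans_mp [MeasurableSpace V₁] [BorelSpace V₁] [MeasurableSpace V₂] [BorelSpace V₂]
    (b : V₁ →ₗ[ℝ] V₁ →ₗ[ℝ] V₂) (g : V₁ × V₂) :
    MeasurePreserving (fun x => ginv x + LTr b x g) (volume : Measure (V₁ × V₂)) volume := by
  have h := MeasurePreserving.skew_product (μa := (volume : Measure V₁)) (μb := volume)
    (μc := (volume : Measure V₂)) (μd := volume) (f := fun z => g.1 - z)
    (Measure.measurePreserving_sub_left volume g.1)
    (g := fun z t => (g.2 - (2⁻¹ : ℝ) • bC b z g.1) - t) (by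
      apply Continuous.measurable
      have : Continuous fun p : V₁ × V₂ => bC b p.1 g.1 :=
        ((bC b).continuous.comp continuous_fst).clm_apply continuous_const
      simp only [Function.uncurry_def]
      exact (continuous_const.sub (this.const_smul _)).sub continuous_snd)
    (Eventually.of_forall fun z => (Measure.measurePreserving_sub_left volume _).map_eq)
  rw [← Measure.volume_eq_prod] at h
  convert! h using 2 with x
  rw [LTr_apply]
  ext
  · simp [ginv]; abel
  · simp [ginv, bC_apply]; abel

lemma LTr_eta (b : V₁ →ₗ[ℝ] V₁ →ₗ[ℝ] V₂) (x g : V₁ × V₂) (w : V₁) :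
    LTr b x (w, (2⁻¹ : ℝ) • b g.1 w) = (w, (2⁻¹ : ℝ) • b (ginv x + LTr b x g).1 w) := by
  rw [LTr_apply, LTr_apply]
  ext
  · simp
  · simp [ginv, smul_sub, smul_add]; abel

lemma riesz_main [MeasurableSpace V₁] [BorelSpace V₁] [MeasurableSpace V₂] [BorelSpace V₂]
    (hd1 : 1 ≤ Module.finrank ℝ V₁) (hd2 : 1 ≤ Module.finrank ℝ V₂)
    (b : V₁ →ₗ[ℝ] V₁ →ₗ[ℝ] V₂) (hskew : ∀ z z' : V₁, b z z' = - b z' z)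
    (J : V₂ → V₁ →ₗ[ℝ] V₁) (hJ : ∀ (t : V₂) (z z' : V₁), ⟪J t z, z'⟫ = ⟪b z z', t⟫)
    (hH : ∀ (t : V₂) (z : V₁), ‖J t z‖ = ‖t‖ * ‖z‖)
    (ρ : V₁ × V₂ → ℝ) (hρc : Continuous ρ) (hρ0 : ∀ g, 0 ≤ ρ g)
    (hρs : HasCompactSupport ρ)
    (α : ℝ) (hα : 1 ≤ -α)
    (F : V₁ × V₂ → ℝ)
    (hF : ∀ g : V₁ × V₂, F g = ∫ g' : V₁ × V₂, ρ g' * Ng (gmul b (ginv g') g) ^ (-α)) :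
    ContDiff ℝ 2 F ∧ ∀ g : V₁ × V₂, 0 ≤ hInfLap b F g := by
  have hd1' := finrank_two hd1 hd2 b hskew J hJ hH
  set s : ℝ := -α / 4 with hs
  have hs4 : 1 / 4 ≤ s := by rw [hs]; linarith
  set R : V₁ × V₂ → ℝ →L[ℝ] ℝ := fun x => ρ x • ContinuousLinearMap.id ℝ ℝ with hR
  have hRc : Continuous R := hρc.smul continuous_const
  have hRs : HasCompactSupport R := hρs.smul_right
  have hL := LTr_cont b
  have hc := ginv_cont (V₁ := V₁) (V₂ := V₂)
  have hT := trans_mp b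
  have hFe : F = Iop volume ginv (LTr b) R (K0 s 0) := by
    funext g
    rw [hF, Iop]
    refine integral_congr_ae (Eventually.of_forall fun x => ?_)
    simp only [trans_eq, hR, K0, Ng, smul_apply, ContinuousLinearMap.id_apply, smul_eq_mul, add_zero]
    rw [← Real.rpow_mul (aF_nonneg _)]
    congr 2
    rw [hs]; ring
  have D1 : ∀ x, HasFDerivAt F (Iop volume ginv (LTr b) (Rder (LTr b) R) (K1 s 0) x) x := by
    rw [hFe]
    exact Iop_limit_hasFDerivAt hc hL hRc hRs hT (conv0 hd1' hd2 hs4) (conv1 hd1' hd2 hs4)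
      (fun n x => K0_hasFDerivAt (eps_pos n) x)
  have hR1c := Rder_cont hL hRc
  have hR1s := Rder_supp (L := LTr b) hRs
  have hR2c := Rder_cont hL hR1c
  have hR2s := Rder_supp (L := LTr b) hR1s
  have D2 : ∀ x, HasFDerivAt (Iop volume ginv (LTr b) (Rder (LTr b) R) (K1 s 0))
      (Iop volume ginv (LTr b) (Rder (LTr b) (Rder (LTr b) R)) (K2 s 0) x) x :=
    Iop_limit_hasFDerivAt hc hL hR1c hR1s hT (conv1 hd1' hd2 hs4) (conv2 hd1' hd2 hs4)
      (fun n x => K1_hasFDerivAt (eps_pos n) x)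
  have hcv2 := conv2 (V₁ := V₁) (V₂ := V₂) hd1' hd2 hs4
  have C2 : Continuous (Iop volume ginv (LTr b) (Rder (LTr b) (Rder (LTr b) R)) (K2 s 0)) :=
    Iop_cont hc hL hR2c hR2s hT hcv2
      (fun n => Iop_cont_smooth hc hL hR2c hR2s (K2_cont (eps_pos n)))
  refine ⟨?_, fun g => ?_⟩
  · have := contDiff_succ_iff_hasFDerivAt (𝕜 := ℝ) (f := F) (n := 1)
    exact this.2 ⟨_, contDiff_one_iff_hasFDerivAt.2 ⟨_, C2, D2⟩, D1⟩
  · obtain ⟨w, hw⟩ := hInf_eq b hskew D1 D2 g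
    rw [hw]
    obtain ⟨_, _, _, _, hb⟩ := Iop_bound (μ := volume) hc hL hR2c hR2s hT {g} isCompact_singleton
    have hi := (hb _ hcv2.loc g rfl).1
    rw [Iop, ContinuousLinearMap.integral_apply hi,
      ContinuousLinearMap.integral_apply (hi.apply_continuousLinearMap _)]
    refine integral_nonneg fun x => ?_
    simp only [Rder_apply, ContinuousLinearMap.comp_apply, LTr_eta, hR, smul_apply,
      ContinuousLinearMap.id_apply, smul_eq_mul]
    exact mul_nonneg (hρ0 x) (K2_nonneg b hskew J hJ hH hs4 _ w)

end RieszAux4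



theorem riesz_htype_main_infty_subharmonic {V₁ V₂ : Type*} [NormedAddCommGroup V₁] [InnerProductSpace ℝ V₁]
    [FiniteDimensional ℝ V₁] [NormedAddCommGroup V₂] [InnerProductSpace ℝ V₂]
    [FiniteDimensional ℝ V₂] (m k : ℕ) (hm : 1 ≤ m) (hk : 1 ≤ k)
    (hdV₁ : Module.finrank ℝ V₁ = m) (hdV₂ : Module.finrank ℝ V₂ = k)
    (b : V₁ →ₗ[ℝ] V₁ →ₗ[ℝ] V₂) (hskew : ∀ z z' : V₁, b z z' = - b z' z)
    (J : V₂ → V₁ →ₗ[ℝ] V₁) (hJ : ∀ (t : V₂) (z z' : V₁), ⟪J t z, z'⟫ = ⟪b z z', t⟫) (hH : ∀ (t : V₂) (z : V₁), ‖J t z‖ = ‖t‖ * ‖z‖) [MeasurableSpace V₁] [BorelSpace V₁] [MeasurableSpace V₂] [BorelSpace V₂]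
    (ρ : V₁ × V₂ → ℝ) (hρc : Continuous ρ) (hρ0 : ∀ g, 0 ≤ ρ g)
    (hρs : HasCompactSupport ρ)
    (α : ℝ) (hα : 1 ≤ -α)
    (F : V₁ × V₂ → ℝ)
    (hF : ∀ g : V₁ × V₂, F g = ∫ g' : V₁ × V₂, ρ g' * Ng (gmul b (ginv g') g) ^ (-α)) :
    ContDiff ℝ 2 F ∧ ∀ g : V₁ × V₂, 0 ≤ hInfLap b F g := by
  exact riesz_main (by omega) (by omega) b hskew J hJ hH ρ hρc hρ0 hρs α hα F hF
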